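/- arXiv:0912.5173 — 3 statements merged into one kernel-verified Lean document; each statement's English description precedes it below -/
import Mathlib

section
/- Fix integers N ≥ 1, p ≥ 2, s ≥ 1, reals β and γ̃ > 0, and set θ = tanh β. For k, k′ ∈ ℕ and index families I : {1,…,k} → {1,…,N}^p, L : {1,…,k′} → {1,…,N}^{p−1}, let w_{I,L}(σ) = exp(β Σ_{ν=1}^k Π_{j=1}^p σ_{I(ν,j)} + β Σ_{μ=1}^{k′} Π_{j=1}^{p−1} σ_{L(μ,j)}) be the perturbed Gibbs weight on {−1,+1}^N, ω_{I,L}(g) = Σ_σ g(σ)w_{I,L}(σ)/Σ_σ w_{I,L}(σ) the Gibbs state, and Ω_{I,L} its s-fold product state on s replicas. For F : ({−1,+1}^N)^s → ℝ define the quenched average ⟨F⟩_t = Σ_{k,k′} e^{−γ̃N}(γ̃N)^k/k! · e^{−2γ̃t}(2γ̃t)^{k′}/k′! · N^{−pk} N^{−(p−1)k′} Σ_{I} Σ_{L} Ω_{I,L}(F). Then t ↦ ⟨F⟩_t is differentiable for t > 0 and d⟨F⟩_t/dt = 2γ̃ ( E_t[ N^{−(p−1)} Σ_{(i_1,…,i_{p−1})∈{1,…,N}^{p−1}}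 Ω_{I,L}( F · Π_{a=1}^s (1 + θ Π_{j=1}^{p−1} σ^a_{i_j}) ) / (1 + θ ω_{I,L}(Π_{j=1}^{p−1} σ_{i_j}))^s ] − ⟨F⟩_t ), where E_t denotes the same quenched average over (k, I, k′, L). -/
open scoped BigOperators

noncomputable section

/-- The value of a Boolean spin: `true ↦ 1`, `false ↦ -1`. -/
def spin (b : Bool) : ℝ := if b then 1 else -1

/-- Poisson probability mass function with mean `c`. -/
def poisProb (c : ℝ) (k : ℕ) : ℝ := Real.exp (-c) * c ^ k / (Nat.factorial k)

/-- Diluted p-spin energy (minus the Hamiltonian) for an index family `I`. -/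
def energy (N p k : ℕ) (I : Fin k → Fin p → Fin N) (σ : Fin N → Bool) : ℝ :=
  ∑ ν : Fin k, ∏ j : Fin p, spin (σ (I ν j))

/-- Perturbed Gibbs weight `w_{I,L}(σ)` with `k` p-body terms and `k'` (p−1)-body terms. -/
def gibbsWeight (N p k k' : ℕ) (β : ℝ) (I : Fin k → Fin p → Fin N)
    (L : Fin k' → Fin (p - 1) → Fin N) (σ : Fin N → Bool) : ℝ :=
  Real.exp (β * energy N p k I σ + β * energy N (p - 1) k' L σ)

/-- Gibbs state `ω(g)` for a weight `w`. -/
def gibbsAvg (N : ℕ) (w : (Fin N → Bool) → ℝ) (g : (Fin N → Bool) → ℝ) : ℝ :=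
  (∑ σ : Fin N → Bool, g σ * w σ) / ∑ σ : Fin N → Bool, w σ

/-- `s`-fold product (replicated) Gibbs state `Ω(F)` for a weight `w`. -/
def replicaAvg (N s : ℕ) (w : (Fin N → Bool) → ℝ)
    (F : (Fin s → Fin N → Bool) → ℝ) : ℝ :=
  (∑ τ : Fin s → Fin N → Bool, F τ * ∏ a : Fin s, w (τ a)) /
    (∑ σ : Fin N → Bool, w σ) ^ s

/-- Quenched average over `k ∼ Poisson(gN)`, `k' ∼ Poisson(2gt)` and i.i.d. uniform
index families `I`, `L`. -/
def quenchedPert (N p : ℕ) (g t : ℝ)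
    (f : (k : ℕ) → (k' : ℕ) → (Fin k → Fin p → Fin N) →
      (Fin k' → Fin (p - 1) → Fin N) → ℝ) : ℝ :=
  ∑' k : ℕ, ∑' k' : ℕ,
    poisProb (g * N) k * poisProb (2 * g * t) k' *
      ((N : ℝ) ^ (p * k))⁻¹ * ((N : ℝ) ^ ((p - 1) * k'))⁻¹ *
      ∑ I : Fin k → Fin p → Fin N, ∑ L : Fin k' → Fin (p - 1) → Fin N, f k k' I L

/-- Poisson averages of a bounded sequence are absolutely summable. -/
theorem summable_poisProb (c : ℝ) : Summable (fun n => ‖poisProb c n‖) := by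
  have h := ((Real.summable_pow_div_factorial c).mul_left (Real.exp (-c))).norm
  simpa only [poisProb, mul_div_assoc] using h

/-- Derivative of an exponential generating function with bounded coefficients. -/
theorem hasDerivAt_tsum_pow_div_factorial {B : ℕ → ℝ} {C : ℝ} (hB : ∀ n, |B n| ≤ C) (c : ℝ) :
    HasDerivAt (fun x : ℝ => ∑' n : ℕ, x ^ n / n.factorial * B n)
      (∑' n : ℕ, c ^ n / n.factorial * B (n + 1)) c := by
  have hC : 0 ≤ C := (abs_nonneg _).trans (hB 0)
  set R : ℝ := |c| + 1 with hR
  have hR0 : 0 ≤ R := by positivity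
  have hshift (x : ℝ) (n : ℕ) :
      ((n + 1 : ℕ) : ℝ) * x ^ (n + 1 - 1) / (n + 1).factorial = x ^ n / n.factorial := by
    rw [Nat.factorial_succ, Nat.add_sub_cancel]
    push_cast
    field_simp
  have hu : Summable (fun n : ℕ => (n : ℝ) * R ^ (n - 1) / n.factorial * C) := by
    refine Summable.mul_right C ((summable_nat_add_iff 1).mp ?_)
    simpa only [hshift] using Real.summable_pow_div_factorial R
  have hbound : ∀ (n : ℕ) (y : ℝ), y ∈ Metric.ball (0 : ℝ) R →
      ‖(n : ℝ) * y ^ (n - 1) / n.factorial * B n‖ ≤ (n : ℝ) * R ^ (n - 1) / n.factorial * C := by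
    intro n y hy
    have hy' : |y| ≤ R := by simpa using (mem_ball_zero_iff.mp hy).le
    rw [Real.norm_eq_abs, abs_mul, abs_div, abs_mul, abs_pow, Nat.abs_cast, Nat.abs_cast]
    gcongr
    exact hB n
  have hc : c ∈ Metric.ball (0 : ℝ) R := by simp [hR]
  have hsum0 : Summable (fun n : ℕ => c ^ n / n.factorial * B n) := by
    refine Summable.of_norm_bounded ((Real.summable_pow_div_factorial |c|).mul_right C) ?_
    intro n
    rw [Real.norm_eq_abs, abs_mul, abs_div, abs_pow, Nat.abs_cast]
    gcongr
    exact hB n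
  have key := hasDerivAt_tsum_of_isPreconnected hu Metric.isOpen_ball
    (convex_ball (0 : ℝ) R).isPreconnected
    (g := fun n x => x ^ n / n.factorial * B n)
    (g' := fun n y => (n : ℝ) * y ^ (n - 1) / n.factorial * B n)
    (fun n y _ => ((hasDerivAt_pow n y).div_const _).mul_const _) hbound hc hsum0 hc
  have hs' : Summable (fun n : ℕ => (n : ℝ) * c ^ (n - 1) / n.factorial * B n) :=
    Summable.of_norm_bounded hu (fun n => hbound n c hc)
  rw [hs'.tsum_eq_zero_add] at key
  simpa only [hshift, Nat.cast_zero, zero_mul, zero_div, zero_add] using key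

/-- Differentiating a Poisson average in its mean gives the Poisson average of the
forward difference. -/
theorem hasDerivAt_tsum_poisProb {B : ℕ → ℝ} {C : ℝ} (hB : ∀ n, |B n| ≤ C) (c : ℝ) :
    HasDerivAt (fun x : ℝ => ∑' n : ℕ, poisProb x n * B n)
      (∑' n : ℕ, poisProb c n * B (n + 1) - ∑' n : ℕ, poisProb c n * B n) c := by
  have hfac (x : ℝ) (b : ℕ → ℝ) : ∑' n : ℕ, poisProb x n * b n =
      Real.exp (-x) * ∑' n : ℕ, x ^ n / n.factorial * b n := by
    rw [← tsum_mul_left]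
    exact tsum_congr fun n => by rw [poisProb]; ring
  simp only [hfac]
  refine ((hasDerivAt_neg c).exp.mul (hasDerivAt_tsum_pow_div_factorial hB c)).congr_deriv ?_
  ring

/-- Average over uniformly chosen index families with `k` and `k'` terms. -/
def indexAvg (N p : ℕ)
    (f : (k : ℕ) → (k' : ℕ) → (Fin k → Fin p → Fin N) →
      (Fin k' → Fin (p - 1) → Fin N) → ℝ) (k k' : ℕ) : ℝ :=
  ((N : ℝ) ^ (p * k))⁻¹ * ((N : ℝ) ^ ((p - 1) * k'))⁻¹ *
    ∑ I : Fin k → Fin p → Fin N, ∑ L : Fin k' → Fin (p - 1) → Fin N, f k k' I L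

theorem abs_indexAvg_le {N p : ℕ} (hN : 1 ≤ N)
    {f : (k : ℕ) → (k' : ℕ) → (Fin k → Fin p → Fin N) →
      (Fin k' → Fin (p - 1) → Fin N) → ℝ} {C : ℝ}
    (hf : ∀ k k' I L, |f k k' I L| ≤ C) (k k' : ℕ) : |indexAvg N p f k k'| ≤ C := by
  have hN' : (0 : ℝ) < N := by exact_mod_cast hN
  have hsum : |∑ I : Fin k → Fin p → Fin N, ∑ L : Fin k' → Fin (p - 1) → Fin N, f k k' I L| ≤
      (N : ℝ) ^ (p * k) * ((N : ℝ) ^ ((p - 1) * k') * C) := by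
    calc |∑ I : Fin k → Fin p → Fin N, ∑ L : Fin k' → Fin (p - 1) → Fin N, f k k' I L|
        ≤ ∑ I : Fin k → Fin p → Fin N, ∑ L : Fin k' → Fin (p - 1) → Fin N, C :=
          (Finset.abs_sum_le_sum_abs _ _).trans (Finset.sum_le_sum fun I _ =>
            (Finset.abs_sum_le_sum_abs _ _).trans (Finset.sum_le_sum fun L _ => hf k k' I L))
      _ = _ := by
          simp [pow_mul]
  rw [indexAvg, abs_mul, abs_of_pos (by positivity), ← mul_inv, inv_mul_le_iff₀ (by positivity),
    mul_assoc]
  exact hsum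

/-- Quenched averages of bounded observables may be computed by averaging over the
number of `p`-body terms first. -/
theorem quenchedPert_eq_tsum {N p : ℕ} (g t : ℝ)
    {f : (k : ℕ) → (k' : ℕ) → (Fin k → Fin p → Fin N) →
      (Fin k' → Fin (p - 1) → Fin N) → ℝ} {C : ℝ}
    (hf : ∀ k k', |indexAvg N p f k k'| ≤ C) :
    quenchedPert N p g t f = ∑' k' : ℕ, poisProb (2 * g * t) k' *
      ∑' k : ℕ, poisProb (g * N) k * indexAvg N p f k k' := by
  have hterm : quenchedPert N p g t f = ∑' k : ℕ, ∑' k' : ℕ,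
      poisProb (g * N) k * poisProb (2 * g * t) k' * indexAvg N p f k k' := by
    simp only [quenchedPert, indexAvg, mul_assoc]
  rw [hterm, Summable.tsum_comm]
  · refine tsum_congr fun k' => ?_
    rw [← tsum_mul_left]
    exact tsum_congr fun k => by ring
  · refine Summable.of_norm_bounded (((summable_poisProb (2 * g * t)).mul_of_nonneg
      (summable_poisProb (g * N)) (fun _ => norm_nonneg _)
      (fun _ => norm_nonneg _)).mul_right C) ?_
    rintro ⟨k', k⟩
    simp only [Function.uncurry, norm_mul]
    rw [mul_comm ‖poisProb (g * N) k‖]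
    gcongr
    exact hf k k'

theorem abs_replicaAvg_le {N s : ℕ} {w : (Fin N → Bool) → ℝ} (hw : ∀ σ, 0 < w σ)
    (F : (Fin s → Fin N → Bool) → ℝ) : |replicaAvg N s w F| ≤ ∑ τ, |F τ| := by
  have hZ : 0 < ∑ σ, w σ := Finset.sum_pos (fun σ _ => hw σ) Finset.univ_nonempty
  rw [replicaAvg, abs_div, abs_of_pos (pow_pos hZ s), div_le_iff₀ (pow_pos hZ s), Finset.sum_mul]
  refine (Finset.abs_sum_le_sum_abs _ _).trans (Finset.sum_le_sum fun τ _ => ?_)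
  have hprod : ∏ a : Fin s, w (τ a) ≤ (∑ σ, w σ) ^ s := by
    refine (Finset.prod_le_prod (fun a _ => (hw _).le) (fun a _ =>
      Finset.single_le_sum (fun σ _ => (hw σ).le) (Finset.mem_univ (τ a)))).trans ?_
    simp
  rw [abs_mul, abs_of_pos (Finset.prod_pos fun a _ => hw (τ a))]
  gcongr

theorem prod_spin_eq_one_or_neg_one {ι : Type*} (S : Finset ι) (b : ι → Bool) :
    ∏ j ∈ S, spin (b j) = 1 ∨ ∏ j ∈ S, spin (b j) = -1 := by
  refine Finset.prod_induction _ (fun x : ℝ => x = 1 ∨ x = -1) ?_ (Or.inl rfl) ?_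
  · rintro x y (rfl | rfl) (rfl | rfl) <;> simp
  · intro j _
    cases b j <;> simp [spin]

theorem exp_mul_eq_cosh_mul {β x : ℝ} (hx : x = 1 ∨ x = -1) :
    Real.exp (β * x) = Real.cosh β * (1 + Real.tanh β * x) := by
  have hc : Real.cosh β ≠ 0 := (Real.cosh_pos β).ne'
  have : Real.cosh β * (1 + Real.tanh β * x) = Real.cosh β + Real.sinh β * x := by
    rw [Real.tanh_eq_sinh_div_cosh]
    field_simp
  rw [this]
  rcases hx with rfl | rfl
  · simp [Real.cosh_add_sinh]
  · simp [← sub_eq_add_neg, Real.cosh_sub_sinh]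

/-- Adding one `(p-1)`-body term multiplies the Gibbs weight by `cosh β (1 + θ ∏ σ)`. -/
theorem gibbsWeight_cons (N p k k' : ℕ) (β : ℝ) (I : Fin k → Fin p → Fin N)
    (ι : Fin (p - 1) → Fin N) (L : Fin k' → Fin (p - 1) → Fin N) (σ : Fin N → Bool) :
    gibbsWeight N p k (k' + 1) β I (Fin.cons ι L) σ =
      Real.cosh β * (1 + Real.tanh β * ∏ j, spin (σ (ι j))) * gibbsWeight N p k k' β I L σ := by
  rw [← exp_mul_eq_cosh_mul (prod_spin_eq_one_or_neg_one _ _)]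
  simp only [gibbsWeight, energy, ← Real.exp_add, Fin.sum_univ_succ, Fin.cons_zero, Fin.cons_succ]
  ring_nf

/-- The replicated Gibbs state for a weight tilted by the factor `c (1 + θ X)`. -/
theorem replicaAvg_tilt {N s : ℕ} {w : (Fin N → Bool) → ℝ} (hw : ∀ σ, 0 < w σ) {c : ℝ}
    (hc : c ≠ 0) (θ : ℝ) (X : (Fin N → Bool) → ℝ) (F : (Fin s → Fin N → Bool) → ℝ) :
    replicaAvg N s (fun σ => c * (1 + θ * X σ) * w σ) F =
      replicaAvg N s w (fun τ => F τ * ∏ a, (1 + θ * X (τ a))) /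
        (1 + θ * gibbsAvg N w X) ^ s := by
  have hZ : 0 < ∑ σ, w σ := Finset.sum_pos (fun σ _ => hw σ) Finset.univ_nonempty
  have hden : ∑ σ, c * (1 + θ * X σ) * w σ = c * ((∑ σ, w σ) * (1 + θ * gibbsAvg N w X)) := by
    have : (∑ σ, w σ) * (1 + θ * gibbsAvg N w X) = ∑ σ, w σ + θ * ∑ σ, X σ * w σ := by
      rw [gibbsAvg]
      field_simp
    rw [this, Finset.mul_sum, ← Finset.sum_add_distrib, Finset.mul_sum]
    exact Finset.sum_congr rfl fun σ _ => by ring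
  have hnum : ∑ τ : Fin s → Fin N → Bool, F τ * ∏ a, (c * (1 + θ * X (τ a)) * w (τ a)) =
      c ^ s * ∑ τ : Fin s → Fin N → Bool,
        (F τ * ∏ a, (1 + θ * X (τ a))) * ∏ a, w (τ a) := by
    rw [Finset.mul_sum]
    refine Finset.sum_congr rfl fun τ _ => ?_
    simp only [Finset.prod_mul_distrib, Finset.prod_const, Finset.card_univ, Fintype.card_fin]
    ring
  rw [replicaAvg, replicaAvg, hden, hnum, mul_pow, mul_pow, mul_div_mul_left _ _ (pow_ne_zero s hc),
    div_div]

/-- Averaging over one fresh `(p-1)`-tuple raises the number of `(p-1)`-body terms by one. -/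
theorem indexAvg_cons (N p : ℕ)
    (f : (k : ℕ) → (k' : ℕ) → (Fin k → Fin p → Fin N) →
      (Fin k' → Fin (p - 1) → Fin N) → ℝ) (k k' : ℕ) :
    indexAvg N p (fun k k' I L => ((N : ℝ) ^ (p - 1))⁻¹ *
      ∑ ι : Fin (p - 1) → Fin N, f k (k' + 1) I (Fin.cons ι L)) k k' =
      indexAvg N p f k (k' + 1) := by
  have hL (I : Fin k → Fin p → Fin N) :
      ∑ L : Fin (k' + 1) → Fin (p - 1) → Fin N, f k (k' + 1) I L =
        ∑ L : Fin k' → Fin (p - 1) → Fin N, ∑ ι : Fin (p - 1) → Fin N,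
          f k (k' + 1) I (Fin.cons ι L) := by
    rw [← (Fin.consEquiv fun _ : Fin (k' + 1) => Fin (p - 1) → Fin N).sum_comp,
      Fintype.sum_prod_type_right]
    rfl
  simp only [indexAvg, hL, ← Finset.mul_sum, mul_add, mul_one, pow_add, mul_inv]
  ring

/-- **Exact streaming identity** (the source of Proposition 1 of the paper):
the `t`-derivative of the quenched replicated average `⟨F⟩_t` adds one new
(p−1)-body term with a fresh uniformly chosen index tuple to each of the `s` replicas. -/
theorem streaming_identity (N p s : ℕ) (hN : 1 ≤ N) (hp : 2 ≤ p) (hs : 1 ≤ s)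
    (β g : ℝ) (hg : 0 < g) (F : (Fin s → Fin N → Bool) → ℝ)
    (t : ℝ) (ht : 0 < t) :
    HasDerivAt
      (fun u : ℝ => quenchedPert N p g u (fun k k' I L =>
        replicaAvg N s (gibbsWeight N p k k' β I L) F))
      (2 * g *
        (quenchedPert N p g t (fun k k' I L =>
            ((N : ℝ) ^ (p - 1))⁻¹ * ∑ ι : Fin (p - 1) → Fin N,
              replicaAvg N s (gibbsWeight N p k k' β I L)
                  (fun τ => F τ * ∏ a : Fin s,
                    (1 + Real.tanh β * ∏ j : Fin (p - 1), spin (τ a (ι j)))) /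
                (1 + Real.tanh β * gibbsAvg N (gibbsWeight N p k k' β I L)
                  (fun σ => ∏ j : Fin (p - 1), spin (σ (ι j)))) ^ s)
          - quenchedPert N p g t (fun k k' I L =>
              replicaAvg N s (gibbsWeight N p k k' β I L) F)))
      t := by
  set φ : (k : ℕ) → (k' : ℕ) → (Fin k → Fin p → Fin N) → (Fin k' → Fin (p - 1) → Fin N) → ℝ :=
    fun k k' I L => replicaAvg N s (gibbsWeight N p k k' β I L) F with hφ
  have hw (k k' : ℕ) (I : Fin k → Fin p → Fin N) (L : Fin k' → Fin (p - 1) → Fin N)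
      (σ : Fin N → Bool) : 0 < gibbsWeight N p k k' β I L σ := Real.exp_pos _
  have hA : ∀ k k', |indexAvg N p φ k k'| ≤ ∑ τ, |F τ| :=
    abs_indexAvg_le hN fun k k' I L => abs_replicaAvg_le (hw k k' I L) F
  have hcons (k k' : ℕ) (I : Fin k → Fin p → Fin N) (L : Fin k' → Fin (p - 1) → Fin N)
      (ι : Fin (p - 1) → Fin N) :
      replicaAvg N s (gibbsWeight N p k k' β I L)
          (fun τ => F τ * ∏ a : Fin s,
            (1 + Real.tanh β * ∏ j : Fin (p - 1), spin (τ a (ι j)))) /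
        (1 + Real.tanh β * gibbsAvg N (gibbsWeight N p k k' β I L)
          (fun σ => ∏ j : Fin (p - 1), spin (σ (ι j)))) ^ s =
      φ k (k' + 1) I (Fin.cons ι L) := by
    rw [← replicaAvg_tilt (hw k k' I L) (Real.cosh_pos β).ne' (Real.tanh β)
      (fun σ => ∏ j : Fin (p - 1), spin (σ (ι j))) F, hφ]
    congr 1
    funext σ
    exact (gibbsWeight_cons N p k k' β I ι L σ).symm
  simp only [hcons]
  rw [quenchedPert_eq_tsum g t (fun k k' => (indexAvg_cons N p φ k k').symm ▸ hA k (k' + 1))]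
  simp only [indexAvg_cons, quenchedPert_eq_tsum g _ hA]
  have hB (k' : ℕ) : |∑' k, poisProb (g * N) k * indexAvg N p φ k k'| ≤
      (∑' k, ‖poisProb (g * N) k‖) * ∑ τ, |F τ| := by
    rw [← tsum_mul_right]
    rw [← Real.norm_eq_abs]
    refine tsum_of_norm_bounded ((summable_poisProb (g * N)).mul_right (∑ τ, |F τ|)).hasSum fun k => ?_
    rw [norm_mul]
    gcongr
    exact hA k k'
  have hlin : HasDerivAt (fun u : ℝ => 2 * g * u) (2 * g) t := by
    simpa using (hasDerivAt_id t).const_mul (2 * g)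
  have key := (hasDerivAt_tsum_poisProb hB (2 * g * t)).comp t hlin
  rwa [mul_comm _ (2 * g)] at key
end
end

section
/- Let S be a finite nonempty set, w : S → (0,∞), s : S → {−1,+1}, β ∈ ℝ, θ = tanh β, and r ≥ 1 an integer. Define the Gibbs state ω(f) = Σ_x f(x)w(x)/Σ_x w(x), its r-fold product state Ω on S^r, and the updated state ω′(f) = Σ_x f(x)w(x)e^{βs(x)}/Σ_x w(x)e^{βs(x)} with r-fold product Ω′. Then for every F : S^r → ℝ, Ω′(F) = Ω( F · Π_{a=1}^r (1 + θ s(x_a)) ) / (1 + θ ω(s))^r. -/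
open scoped BigOperators

/-- For a sign `t = ±1`, the exponential of `β * t` is affine in `t`. -/
theorem exp_mul_sign_eq_cosh_mul (β : ℝ) {t : ℝ} (ht : t = 1 ∨ t = -1) :
    Real.exp (β * t) = Real.cosh β * (1 + Real.tanh β * t) := by
  have hc : Real.cosh β ≠ 0 := (Real.cosh_pos β).ne'
  rw [Real.tanh_eq_sinh_div_cosh]
  rcases ht with rfl | rfl
  · rw [mul_one, ← Real.cosh_add_sinh]
    field_simp
  · rw [mul_neg_one, ← Real.cosh_sub_sinh]
    field_simp
    ring

/-- **Replica-update identity** (the core computation in the proof of the streaming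
equation): adding the same single coupling term `β s(x)`, with `s(x) = ±1`, to each of
`r` replicas transforms the replicated Gibbs average as
`Ω′(F) = Ω(F · Π_a (1 + θ s(x_a))) / (1 + θ ω(s))^r` with `θ = tanh β`. -/
theorem replica_update_identity (S : Type*) [Fintype S] [Nonempty S]
    (w : S → ℝ) (hw : ∀ x, 0 < w x)
    (s : S → ℝ) (hs : ∀ x, s x = 1 ∨ s x = -1)
    (β : ℝ) (r : ℕ) (hr : 1 ≤ r) (F : (Fin r → S) → ℝ) :
    (∑ x : Fin r → S, F x * ∏ a : Fin r, (w (x a) * Real.exp (β * s (x a)))) /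
      (∑ y : S, w y * Real.exp (β * s y)) ^ r
    = ((∑ x : Fin r → S,
          (F x * ∏ a : Fin r, (1 + Real.tanh β * s (x a))) * ∏ a : Fin r, w (x a)) /
        (∑ y : S, w y) ^ r) /
      (1 + Real.tanh β * ((∑ y : S, s y * w y) / ∑ y : S, w y)) ^ r := by
  have hexp := fun x => exp_mul_sign_eq_cosh_mul β (hs x)
  have hc : Real.cosh β ^ r ≠ 0 := pow_ne_zero _ (Real.cosh_pos β).ne'
  have hZ : (∑ y : S, w y) ≠ 0 :=
    (Finset.sum_pos (fun y _ => hw y) Finset.univ_nonempty).ne'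
  have hnum : (∑ x : Fin r → S, F x * ∏ a : Fin r, (w (x a) * Real.exp (β * s (x a)))) =
      Real.cosh β ^ r * ∑ x : Fin r → S,
        (F x * ∏ a : Fin r, (1 + Real.tanh β * s (x a))) * ∏ a : Fin r, w (x a) := by
    rw [Finset.mul_sum]
    refine Finset.sum_congr rfl fun x _ => ?_
    simp only [hexp, Finset.prod_mul_distrib, Finset.prod_const, Finset.card_univ,
      Fintype.card_fin]
    ring
  have hden : (∑ y : S, w y * Real.exp (β * s y)) =
      Real.cosh β * ((∑ y : S, w y) + Real.tanh β * ∑ y : S, s y * w y) := by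
    rw [Finset.mul_sum, ← Finset.sum_add_distrib, Finset.mul_sum]
    refine Finset.sum_congr rfl fun y _ => ?_
    rw [hexp]
    ring
  rw [hnum, hden, mul_pow, mul_div_mul_left _ _ hc, div_div, ← mul_pow, mul_add, mul_one,
    mul_left_comm, mul_div_cancel₀ _ hZ]
end

section
/- Let N ≥ 1, let p ≥ 2 be an even integer, β ∈ ℝ, and let i : {1,…,k} → {1,…,N}^p and l : {1,…,k′} → {1,…,N}^{p−1} be arbitrary index families. Then Σ_{σ∈{−1,+1}^N} Σ_{ε∈{−1,+1}} exp( β Σ_{ν=1}^k Π_{j=1}^p σ_{i(ν,j)} + β ε Σ_{μ=1}^{k′} Π_{j=1}^{p−1} σ_{l(μ,j)} ) = 2 Σ_{σ∈{−1,+1}^N} exp( β Σ_{ν=1}^k Π_{j=1}^p σ_{i(ν,j)} + β Σ_{μ=1}^{k′} Π_{j=1}^{p−1} σ_{l(μ,j)} ). -/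
open scoped BigOperators

noncomputable section

theorem spin_not (b : Bool) : spin (!b) = -spin b := by
  cases b <;> simp [spin]

theorem prod_spin_not_of_even {n : ℕ} (hn : Even n) (s : Fin n → Bool) :
    ∏ j, spin (!s j) = ∏ j, spin (s j) := by
  simp [spin_not, Finset.prod_neg, hn.neg_one_pow]

theorem prod_spin_not_of_odd {n : ℕ} (hn : Odd n) (s : Fin n → Bool) :
    ∏ j, spin (!s j) = -∏ j, spin (s j) := by
  simp [spin_not, Finset.prod_neg, hn.neg_one_pow]

/-- **Spin-flip gauge identity** (the step `Z_{N+1} = 2 Z_N ω̃(e^{−βĤ})` in the proof of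
Theorem 1): for even `p`, the extra spin `ε` couples only through (p−1)-body terms and
can be gauged away, so summing over `ε = ±1` contributes a factor `2`. -/
theorem spin_flip_gauge (N p : ℕ) (hN : 1 ≤ N) (hp : 2 ≤ p) (hpeven : Even p)
    (β : ℝ) (k k' : ℕ)
    (i : Fin k → Fin p → Fin N) (l : Fin k' → Fin (p - 1) → Fin N) :
    (∑ σ : Fin N → Bool, ∑ ε : Bool,
        Real.exp (β * ∑ ν : Fin k, ∏ j : Fin p, spin (σ (i ν j)) +
          β * spin ε * ∑ μ : Fin k', ∏ j : Fin (p - 1), spin (σ (l μ j))))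
    = 2 * ∑ σ : Fin N → Bool,
        Real.exp (β * ∑ ν : Fin k, ∏ j : Fin p, spin (σ (i ν j)) +
          β * ∑ μ : Fin k', ∏ j : Fin (p - 1), spin (σ (l μ j))) := by
  have hodd : Odd (p - 1) := Nat.Even.sub_odd (by omega) hpeven odd_one
  simp only [Fintype.sum_bool, Finset.sum_add_distrib, two_mul]
  congr 1
  · simp [spin]
  · refine Fintype.sum_equiv (Equiv.piCongrRight fun _ => Equiv.boolNot) _ _ fun σ => ?_
    have hflip : Equiv.piCongrRight (fun _ => Equiv.boolNot) σ = fun a => !σ a := rfl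
    have hfalse : spin false = -1 := by simp [spin]
    simp only [hflip, hfalse, prod_spin_not_of_even hpeven fun j => σ (i _ j),
      prod_spin_not_of_odd hodd fun j => σ (l _ j), Finset.sum_neg_distrib, mul_neg, mul_one,
      neg_mul]
end
end
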